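/- Let K_ε(s,t) for ε ∈ (0,1) be defined on (0,∞)² by K_ε(s,t) = (st)^{-1/2}((1-εs)/(1+εs))^{1/(2ε)}(((1+ε·min(s,t))/(1-ε·min(s,t)))^{1/ε} − 1)((1-εt)/(1+εt))^{1/(2ε)} when 0 < s,t < 1/ε (with the roles of s and t in the middle factor taken at min(s,t)), and K_ε(s,t) = 0 otherwise. Let K₀(s,t) = (st)^{-1/2}e^{-s}(e^{2·min(s,t)}−1)e^{-t}. Then ∫₀^∞∫₀^∞ |K_ε(s,t) − K₀(s,t)|² dt ds → 0 as ε → 0⁺. -/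

import Mathlib

open MeasureTheory Real Set Filter

/-- The generic kernel. -/
noncomputable def genK (A : ℝ → ℝ) (s t : ℝ) : ℝ :=
  (s * t) ^ (-(1:ℝ)/2) * A s * (((A (min s t)) ^ 2)⁻¹ - 1) * A t

lemma genK_comm (A : ℝ → ℝ) (s t : ℝ) : genK A s t = genK A t s := by
  unfold genK
  rw [min_comm, mul_comm s t]; ring

lemma core_bound (a b m M : ℝ) (hm : 0 < m) (hmM : m ≤ M) (ha : 0 < a) (hb : 0 < b) (ha1 : a ≤ 1)
    (hab : b ≤ a * exp ((m - M) / 2)) (ham : 1 - 2 * m ≤ a ^ 2) :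
    0 ≤ (m * M) ^ (-(1:ℝ)/2) * a * ((a ^ 2)⁻¹ - 1) * b ∧
    ((m * M) ^ (-(1:ℝ)/2) * a * ((a ^ 2)⁻¹ - 1) * b) ^ 2 ≤ exp (m - M) * (5 * (1 + m ^ 2)⁻¹) := by
  have hM : 0 < M := hm.trans_le hmM
  have ha2 : a ^ 2 ≤ 1 := by nlinarith
  have hinv : 0 ≤ (a ^ 2)⁻¹ - 1 := by
    have := (one_le_inv₀ (by positivity : 0 < a ^ 2)).2 ha2
    linarith
  refine ⟨by positivity, ?_⟩
  have hr : ((m * M) ^ (-(1:ℝ)/2)) ^ 2 = (m * M)⁻¹ := by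
    rw [← Real.rpow_natCast, ← Real.rpow_mul (by positivity), ← Real.rpow_neg_one]
    norm_num
  have e1 : ((m * M) ^ (-(1:ℝ)/2) * a * ((a ^ 2)⁻¹ - 1) * b) ^ 2
      = (m * M)⁻¹ * (b / a) ^ 2 * (1 - a ^ 2) ^ 2 := by
    rw [mul_pow, mul_pow, mul_pow, hr]
    field_simp
  rw [e1]
  have h1 : (m * M)⁻¹ ≤ (m ^ 2)⁻¹ := by
    apply inv_anti₀ (by positivity); nlinarith
  have h2 : (b / a) ^ 2 ≤ exp (m - M) := by
    have : b / a ≤ exp ((m - M) / 2) := by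
      rw [div_le_iff₀ ha]; linarith
    calc (b / a) ^ 2 ≤ exp ((m - M) / 2) ^ 2 := by gcongr
      _ = exp (m - M) := by rw [← Real.exp_nat_mul]; congr 1; push_cast; ring
  have h3 : (1 - a ^ 2) ^ 2 ≤ m ^ 2 * (5 * (1 + m ^ 2)⁻¹) := by
    have p1 : (1 - a ^ 2) ^ 2 ≤ 1 := by
      have : 0 < a ^ 2 := by positivity
      nlinarith
    have p2 : (1 - a ^ 2) ^ 2 ≤ (2 * m) ^ 2 := by
      apply pow_le_pow_left₀ <;> linarith
    rw [← mul_assoc, ← div_eq_mul_inv, le_div_iff₀ (by positivity)]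
    nlinarith [mul_le_mul_of_nonneg_right p1 (sq_nonneg m)]
  calc (m * M)⁻¹ * (b / a) ^ 2 * (1 - a ^ 2) ^ 2
      ≤ (m ^ 2)⁻¹ * exp (m - M) * (m ^ 2 * (5 * (1 + m ^ 2)⁻¹)) := by gcongr
    _ = _ := by field_simp

/-- The dominating function. -/
noncomputable def domB (s t : ℝ) : ℝ :=
  5 * (exp (-|s - t|) * (1 + s ^ 2)⁻¹ + exp (-|s - t|) * (1 + t ^ 2)⁻¹)

lemma domB_comm (s t : ℝ) : domB s t = domB t s := by
  unfold domB; rw [abs_sub_comm]; ring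

lemma domB_nonneg (s t : ℝ) : 0 ≤ domB s t := by unfold domB; positivity

lemma genK_bound (A : ℝ → ℝ) (L : ℝ)
    (h0 : ∀ m, 0 < m → m < L → 0 < A m ∧ A m ≤ 1 ∧ 1 - 2 * m ≤ A m ^ 2)
    (h1 : ∀ m M, 0 < m → m ≤ M → M < L → A M ≤ A m * exp ((m - M) / 2))
    (s t : ℝ) (hs : 0 < s) (ht : 0 < t) (hsL : s < L) (htL : t < L) :
    0 ≤ genK A s t ∧ genK A s t ^ 2 ≤ domB s t := by
  wlog h : s ≤ t generalizing s t
  · rw [genK_comm, domB_comm]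
    exact this t s ht hs htL hsL (le_of_not_ge h)
  obtain ⟨a1, a2, a3⟩ := h0 s hs hsL
  have := core_bound (A s) (A t) s t hs h a1 (h0 t ht htL).1 a2 (h1 s t hs h htL) a3
  unfold genK
  rw [min_eq_left h]
  refine ⟨this.1, this.2.trans ?_⟩
  unfold domB
  have e : -|s - t| = s - t := by rw [abs_of_nonpos (by linarith)]; ring
  rw [e]
  have : 0 ≤ exp (s - t) * (1 + t ^ 2)⁻¹ := by positivity
  linarith

/-- The discrete exponential. -/
noncomputable def pE (ε s : ℝ) : ℝ := ((1 - ε * s) / (1 + ε * s)) ^ (1 / (2 * ε))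

lemma pE_sq (ε s : ℝ) (h : 0 < (1 - ε * s) / (1 + ε * s)) :
    pE ε s ^ 2 = ((1 - ε * s) / (1 + ε * s)) ^ (1 / ε) := by
  unfold pE
  rw [← Real.rpow_natCast, ← Real.rpow_mul h.le]
  congr 1
  push_cast
  rw [one_div, one_div, mul_inv]; ring

lemma q_pos (ε s : ℝ) (hε : 0 < ε) (hs : 0 < s) (hs1 : s < 1 / ε) :
    0 < 1 - ε * s ∧ 0 < 1 + ε * s := by
  have : s * ε < 1 := by rwa [lt_div_iff₀ hε] at hs1
  exact ⟨by linarith, by positivity⟩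

lemma pE_props (ε : ℝ) (hε : 0 < ε) (hε1 : ε < 1) (m : ℝ) (hm : 0 < m) (hm1 : m < 1 / ε) :
    0 < pE ε m ∧ pE ε m ≤ 1 ∧ 1 - 2 * m ≤ pE ε m ^ 2 := by
  obtain ⟨h1, h2⟩ := q_pos ε m hε hm hm1
  have hq : 0 < (1 - ε * m) / (1 + ε * m) := div_pos h1 h2
  have hem : 0 < ε * m := by positivity
  refine ⟨Real.rpow_pos_of_pos hq _, Real.rpow_le_one hq.le ?_ (by positivity), ?_⟩
  · rw [div_le_one h2]; linarith
  · rw [pE_sq _ _ hq]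
    have hb := one_add_mul_self_le_rpow_one_add
      (s := (1 - ε * m) / (1 + ε * m) - 1) (by linarith) (p := 1 / ε)
      (by rw [le_div_iff₀ hε]; linarith)
    rw [add_sub_cancel] at hb
    refine le_trans ?_ hb
    have : (1 / ε) * ((1 - ε * m) / (1 + ε * m) - 1) = - (2 * m / (1 + ε * m)) := by
      field_simp; ring
    rw [this]
    have : 2 * m / (1 + ε * m) ≤ 2 * m := div_le_self (by positivity) (by linarith)
    linarith

lemma pE_ratio (ε : ℝ) (hε : 0 < ε) (m M : ℝ) (hm : 0 < m) (hmM : m ≤ M) (hM1 : M < 1 / ε) :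
    pE ε M ≤ pE ε m * exp ((m - M) / 2) := by
  obtain ⟨h1, h2⟩ := q_pos ε m hε hm (hmM.trans_lt hM1)
  obtain ⟨h3, h4⟩ := q_pos ε M hε (hm.trans_le hmM) hM1
  have hle : ε * m ≤ ε * M := by gcongr
  have key : (1 - ε * M) / (1 + ε * M) ≤ (1 - ε * m) / (1 + ε * m) * exp (ε * (m - M)) := by
    have a1 : 1 - ε * M ≤ (1 - ε * m) * exp (ε * (m - M)) := by
      have := Real.add_one_le_exp (ε * (m - M))
      have h5 : 0 ≤ ε * m := by positivity
      calc 1 - ε * M ≤ (1 - ε * m) * (ε * (m - M) + 1) := by nlinarith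
        _ ≤ _ := by gcongr
    calc (1 - ε * M) / (1 + ε * M) ≤ ((1 - ε * m) * exp (ε * (m - M))) / (1 + ε * m) := by
          gcongr
      _ = _ := by ring
  have hq : 0 < (1 - ε * m) / (1 + ε * m) := div_pos h1 h2
  unfold pE
  calc ((1 - ε * M) / (1 + ε * M)) ^ (1 / (2 * ε))
      ≤ ((1 - ε * m) / (1 + ε * m) * exp (ε * (m - M))) ^ (1 / (2 * ε)) := by
        apply Real.rpow_le_rpow _ key (by positivity)
        positivity
    _ = _ := by
        rw [Real.mul_rpow hq.le (exp_pos _).le, ← Real.exp_mul]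
        congr 2
        field_simp

lemma pE_tendsto (s : ℝ) :
    Tendsto (fun ε => pE ε s) (nhdsWithin 0 (Ioi (0:ℝ))) (nhds (exp (-s))) := by
  have hd : HasDerivAt (fun x : ℝ => Real.log ((1 - x * s) / (1 + x * s))) (-2 * s) 0 := by
    have d1 : HasDerivAt (fun x : ℝ => 1 - x * s) (-s) 0 := by
      simpa using ((hasDerivAt_id (0:ℝ)).mul_const s).const_sub 1
    have d2 : HasDerivAt (fun x : ℝ => 1 + x * s) s 0 := by
      simpa using ((hasDerivAt_id (0:ℝ)).mul_const s).const_add 1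
    have := (d1.div d2 (by simp)).log (by simp)
    convert this using 1
    simp only [Pi.div_apply]
    simp; ring
  rw [hasDerivAt_iff_tendsto_slope] at hd
  have hd' := (hd.mono_left (nhdsWithin_mono 0 (fun x (hx : 0 < x) => hx.ne'))).div_const 2
  have hd2 := (Real.continuous_exp.tendsto _).comp hd'
  have e : exp (-2 * s / 2) = exp (-s) := by congr 1; ring
  rw [e] at hd2
  refine hd2.congr' ?_
  have c : Tendsto (fun x : ℝ => (1 - x * s) / (1 + x * s)) (nhdsWithin 0 (Ioi (0:ℝ))) (nhds 1) := by
    have : ContinuousAt (fun x : ℝ => (1 - x * s) / (1 + x * s)) 0 := by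
      apply ContinuousAt.div <;> first | fun_prop | simp
    have := this.tendsto
    simp only [zero_mul, sub_zero, add_zero, div_one] at this
    exact this.mono_left nhdsWithin_le_nhds
  filter_upwards [c.eventually (lt_mem_nhds one_pos), self_mem_nhdsWithin] with x hx hx0
  have hx0 : 0 < x := hx0
  simp only [Function.comp, pE, slope_def_field]
  rw [Real.rpow_def_of_pos hx]
  congr 1
  simp
  field_simp

lemma integrable_domB : Integrable (fun p : ℝ × ℝ => domB p.1 p.2) (volume.prod volume) := by
  have i1 : Integrable (fun x : ℝ => exp (-|x|)) := by
    rw [← integrableOn_univ, ← Iic_union_Ioi (a := (0:ℝ))]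
    refine IntegrableOn.union ?_ ?_
    · refine (integrableOn_exp_Iic 0).congr_fun (fun x hx => ?_) measurableSet_Iic
      simp only [abs_of_nonpos (mem_Iic.1 hx), neg_neg]
    · refine (integrableOn_exp_neg_Ioi 0).congr_fun (fun x hx => ?_) measurableSet_Ioi
      simp only [abs_of_pos (mem_Ioi.1 hx)]
  have h := Integrable.convolution_integrand (ContinuousLinearMap.mul ℝ ℝ)
    (integrable_inv_one_add_sq) i1 (μ := volume) (ν := volume)
  simp only [ContinuousLinearMap.mul_apply'] at h
  have h2 := h.swap
  refine ((h2.add h).const_mul 5).congr (Eventually.of_forall fun p => ?_)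
  simp only [Function.comp, Prod.fst_swap, Prod.snd_swap, domB, Pi.add_apply]
  rw [abs_sub_comm p.2 p.1]
  ring

theorem stmt_14
    (K : ℝ → ℝ → ℝ → ℝ)
    (hK : K = fun ε s t =>
      if 0 < s ∧ s < 1 / ε ∧ 0 < t ∧ t < 1 / ε then
        (s * t) ^ (-(1:ℝ)/2) * ((1 - ε * s) / (1 + ε * s)) ^ (1 / (2 * ε))
          * (((1 + ε * min s t) / (1 - ε * min s t)) ^ (1 / ε) - 1)
          * ((1 - ε * t) / (1 + ε * t)) ^ (1 / (2 * ε))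
      else 0)
    (K₀ : ℝ → ℝ → ℝ)
    (hK₀ : K₀ = fun s t => (s * t) ^ (-(1:ℝ)/2) * Real.exp (-s)
        * (Real.exp (2 * min s t) - 1) * Real.exp (-t)) :
    Tendsto
      (fun ε : ℝ => ∫⁻ s in Ioi (0:ℝ), ∫⁻ t in Ioi (0:ℝ),
        ENNReal.ofReal (|K ε s t - K₀ s t| ^ 2))
      (nhdsWithin 0 (Ioi (0:ℝ))) (nhds 0) := by
  have hKm : ∀ ε, Measurable (fun p : ℝ × ℝ => K ε p.1 p.2) := by
    intro ε
    subst hK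
    refine Measurable.ite ?_ ?_ measurable_const
    · exact (measurableSet_lt measurable_const measurable_fst).inter
        ((measurableSet_lt measurable_fst measurable_const).inter
          ((measurableSet_lt measurable_const measurable_snd).inter
            (measurableSet_lt measurable_snd measurable_const)))
    · fun_prop
  have hK0m : Measurable (fun p : ℝ × ℝ => K₀ p.1 p.2) := by
    subst hK₀
    fun_prop
  have hFm : ∀ ε, Measurable (fun p : ℝ × ℝ => ENNReal.ofReal (|K ε p.1 p.2 - K₀ p.1 p.2| ^ 2)) := by
    intro ε
    have := hKm ε
    exact (((this.sub hK0m).abs).pow_const 2).ennreal_ofReal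
  have hKe : ∀ ε s t, 0 < ε → 0 < s → 0 < t → s < 1 / ε → t < 1 / ε →
      K ε s t = genK (pE ε) s t := by
    intro ε s t hε hs ht hs1 ht1
    have hc : 0 < s ∧ s < 1 / ε ∧ 0 < t ∧ t < 1 / ε := ⟨hs, hs1, ht, ht1⟩
    obtain ⟨h1, h2⟩ := q_pos ε (min s t) hε (lt_min hs ht) (min_lt_of_left_lt hs1)
    have hq := div_pos h1 h2
    rw [hK]
    simp only [if_pos hc]
    unfold genK
    rw [pE_sq _ _ hq, ← Real.inv_rpow hq.le, inv_div]
    rfl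
  have hK0e : ∀ s t, K₀ s t = genK (fun x => exp (-x)) s t := by
    intro s t
    rw [hK₀]
    unfold genK
    simp only
    have : (exp (-(min s t)) ^ 2)⁻¹ = exp (2 * min s t) := by
      rw [← Real.exp_nat_mul, ← Real.exp_neg]; congr 1; push_cast; ring
    rw [this]
  have hK0b : ∀ s t, 0 < s → 0 < t → 0 ≤ K₀ s t ∧ K₀ s t ^ 2 ≤ domB s t := by
    intro s t hs ht
    rw [hK0e]
    refine genK_bound _ (max s t + 1) ?_ ?_ s t hs ht
      (by linarith [le_max_left s t]) (by linarith [le_max_right s t])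
    · intro m hm _
      refine ⟨exp_pos _, by simpa using hm.le, ?_⟩
      rw [← Real.exp_nat_mul]
      have := Real.add_one_le_exp ((2:ℕ) * -m)
      push_cast at this ⊢
      linarith
    · intro m M hm hmM _
      rw [← Real.exp_add]
      apply Real.exp_le_exp.2
      linarith
  have hKb : ∀ ε s t, 0 < ε → ε < 1 → 0 < s → 0 < t → 0 ≤ K ε s t ∧ K ε s t ^ 2 ≤ domB s t := by
    intro ε s t hε hε1 hs ht
    by_cases hc : s < 1 / ε ∧ t < 1 / ε
    · rw [hKe ε s t hε hs ht hc.1 hc.2]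
      exact genK_bound _ (1 / ε) (fun m => pE_props ε hε hε1 m) (fun m M => pE_ratio ε hε m M)
        s t hs ht hc.1 hc.2
    · have : K ε s t = 0 := by
        rw [hK]
        exact if_neg (fun h => hc ⟨h.2.1, h.2.2.2⟩)
      rw [this]
      exact ⟨le_rfl, by simpa using domB_nonneg s t⟩
  set μ : Measure (ℝ × ℝ) := (volume.restrict (Ioi (0:ℝ))).prod (volume.restrict (Ioi (0:ℝ))) with hμ
  have hμ' : μ = (volume.prod volume).restrict (Ioi (0:ℝ) ×ˢ Ioi (0:ℝ)) := by
    rw [hμ, Measure.prod_restrict]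
  have hae : ∀ᵐ p ∂μ, 0 < p.1 ∧ 0 < p.2 := by
    rw [hμ']
    filter_upwards [ae_restrict_mem (measurableSet_Ioi.prod measurableSet_Ioi)] with p hp
    exact hp
  have heq : (fun ε : ℝ => ∫⁻ s in Ioi (0:ℝ), ∫⁻ t in Ioi (0:ℝ),
        ENNReal.ofReal (|K ε s t - K₀ s t| ^ 2))
      = fun ε => ∫⁻ p, ENNReal.ofReal (|K ε p.1 p.2 - K₀ p.1 p.2| ^ 2) ∂μ := by
    funext ε
    rw [hμ, lintegral_prod _ (hFm ε).aemeasurable]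
  rw [heq]
  have h01 : ∀ᶠ ε : ℝ in nhdsWithin 0 (Ioi (0:ℝ)), 0 < ε ∧ ε < 1 :=
    Ioo_mem_nhdsGT one_pos
  have main := tendsto_lintegral_filter_of_dominated_convergence (μ := μ)
    (l := nhdsWithin 0 (Ioi (0:ℝ)))
    (F := fun ε (p : ℝ × ℝ) => ENNReal.ofReal (|K ε p.1 p.2 - K₀ p.1 p.2| ^ 2))
    (f := fun _ => 0)
    (fun p => ENNReal.ofReal (2 * domB p.1 p.2))
    (Eventually.of_forall hFm) ?_ ?_ ?_
  · simpa using main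
  · filter_upwards [h01] with ε hε
    filter_upwards [hae] with p hp
    apply ENNReal.ofReal_le_ofReal
    obtain ⟨a1, a2⟩ := hKb ε p.1 p.2 hε.1 hε.2 hp.1 hp.2
    obtain ⟨b1, b2⟩ := hK0b p.1 p.2 hp.1 hp.2
    rw [sq_abs]
    nlinarith [mul_nonneg a1 b1]
  · have := (integrable_domB.const_mul 2).restrict (s := Ioi (0:ℝ) ×ˢ Ioi (0:ℝ))
    rw [← hμ'] at this
    exact this.lintegral_lt_top.ne
  · filter_upwards [hae] with p hp
    obtain ⟨s, t⟩ := p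
    obtain ⟨hs, ht⟩ := hp
    simp only at hs ht ⊢
    have hlim : Tendsto (fun ε => K ε s t) (nhdsWithin 0 (Ioi (0:ℝ))) (nhds (K₀ s t)) := by
      have hg : Tendsto (fun ε => genK (pE ε) s t) (nhdsWithin 0 (Ioi (0:ℝ))) (nhds (K₀ s t)) := by
        rw [hK0e]
        unfold genK
        exact (((pE_tendsto s).const_mul _).mul
          ((((pE_tendsto (min s t)).pow 2).inv₀ (by positivity)).sub_const 1)).mul (pE_tendsto t)
      refine hg.congr' ?_
      filter_upwards [self_mem_nhdsWithin, Ioo_mem_nhdsGT (one_div_pos.2 hs),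
        Ioo_mem_nhdsGT (one_div_pos.2 ht)] with ε h0 h1 h2
      have h0 : 0 < ε := h0
      refine (hKe ε s t h0 hs ht ?_ ?_).symm
      · exact (lt_one_div h0 hs).1 h1.2
      · exact (lt_one_div h0 ht).1 h2.2
    have h3 := ((hlim.sub_const (K₀ s t)).abs).pow 2
    have h4 := ENNReal.tendsto_ofReal h3
    simpa using h4
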